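/- arXiv:2310.00111 — 2 statements merged into one kernel-verified Lean document; each statement's English description precedes it below -/
import Mathlib

section
/- Let ι be a finite index type, and for each i ∈ ι let Q_i be an isometric complex matrix of size r_i × k_i. Let U be the block-diagonal matrix with diagonal blocks Q_i (so U has rows indexed by Σ i, r_i and columns indexed by Σ i, k_i), let Q̂ be an isometric matrix of size (Σ i, k_i) × q, and set Q := U Q̂ (which is isometric). Then for every complex matrix G with rows indexed by Σ i, r_i and columns indexed by s, and for every vector x ∈ ℂˢ, one has the exact Pythagoras decomposition ‖(G − Q Qᴴ G) x‖² = Σ_{i ∈ ι} ‖(G_i − Q_i Q_iᴴ G_i) x‖² + ‖(I − Q̂ Q̂ᴴ) Uᴴ G x‖², where G_i denotes the row block of G corresponding to index i and ‖·‖ is the Euclidean norm. -/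
open Matrix

namespace Matrix

variable {m n l : Type*} [Fintype m] [Fintype n]

/-- The squared norm of `A x` is the quadratic form of the Gram matrix `Aᴴ * A` at `x`. -/
theorem norm_sq_toEuclideanLin_apply [DecidableEq n] (A : Matrix m n ℂ) (x : EuclideanSpace ℂ n) :
    ((‖toEuclideanLin A x‖ ^ 2 : ℝ) : ℂ) = star x.ofLp ⬝ᵥ ((Aᴴ * A) *ᵥ x.ofLp) := by
  have h := inner_self_eq_norm_sq_to_K (𝕜 := ℂ) (toEuclideanLin A x)
  rw [EuclideanSpace.inner_eq_star_dotProduct, ofLp_toLpLin, toLin'_apply, dotProduct_comm,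
    star_mulVec, ← dotProduct_mulVec, mulVec_mulVec] at h
  simpa using h.symm

theorem norm_sq_toEuclideanLin_eq_add {m₁ m₂ : Type*} [Fintype m₁] [Fintype m₂] [DecidableEq n]
    {A : Matrix m n ℂ} {B : Matrix m₁ n ℂ} {C : Matrix m₂ n ℂ} (h : Aᴴ * A = Bᴴ * B + Cᴴ * C)
    (x : EuclideanSpace ℂ n) :
    ‖toEuclideanLin A x‖ ^ 2 = ‖toEuclideanLin B x‖ ^ 2 + ‖toEuclideanLin C x‖ ^ 2 := by
  apply Complex.ofReal_injective
  rw [Complex.ofReal_add]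
  simp only [norm_sq_toEuclideanLin_apply, h, add_mulVec, dotProduct_add]

/-- The Gram matrix of the residual of the orthogonal projection onto the range of an isometric
matrix. -/
theorem conjTranspose_mul_self_sub_isometry [DecidableEq n] {V : Matrix m n ℂ} (hV : Vᴴ * V = 1)
    (G : Matrix m l ℂ) :
    (G - V * Vᴴ * G)ᴴ * (G - V * Vᴴ * G) = Gᴴ * G - Gᴴ * V * Vᴴ * G := by
  have h : Vᴴ * (V * (Vᴴ * G)) = Vᴴ * G := by rw [← Matrix.mul_assoc, hV, Matrix.one_mul]
  simp only [conjTranspose_sub, conjTranspose_mul, conjTranspose_conjTranspose, Matrix.mul_sub,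
    Matrix.sub_mul, Matrix.mul_assoc, h]
  abel

/-- The squared norm of `A x` is the sum of the squared norms of its row blocks. -/
theorem sum_norm_sq_toEuclideanLin_rowBlock {ι : Type*} [Fintype ι] {κ : ι → Type*}
    [∀ i, Fintype (κ i)] [DecidableEq n] (A : Matrix (Σ i, κ i) n ℂ) (x : EuclideanSpace ℂ n) :
    ∑ i, ‖toEuclideanLin (A.submatrix (Sigma.mk i) id) x‖ ^ 2 = ‖toEuclideanLin A x‖ ^ 2 := by
  simp only [EuclideanSpace.norm_sq_eq, Fintype.sum_sigma]
  rfl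

theorem submatrix_blockDiagonal'_mul {ι : Type*} [Fintype ι] [DecidableEq ι] {κ μ : ι → Type*}
    [∀ i, Fintype (μ i)] (Q : ∀ i, Matrix (κ i) (μ i) ℂ) (G : Matrix (Σ i, μ i) l ℂ) (i : ι) :
    (blockDiagonal' Q * G).submatrix (Sigma.mk i) id = Q i * G.submatrix (Sigma.mk i) id := by
  ext a b
  simp only [submatrix_apply, mul_apply, Fintype.sum_sigma, id]
  rw [Finset.sum_eq_single i]
  · simp
  · intro j _ hj
    simp [blockDiagonal'_apply_ne _ _ _ hj.symm]
  · simp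

end Matrix

/-- Pythagoras decomposition of the compression error.
For isometric blocks `Q i`, the block-diagonal matrix `U = blockDiagonal' Q`, an isometric
`Q̂`, and `Qfull = U * Q̂`, the squared Euclidean norm of `(G - Qfull Qfullᴴ G) x` splits
exactly into the children's contributions and the parent's contribution. -/
theorem pythagoras_error_decomposition
    {ι : Type*} [Fintype ι] [DecidableEq ι]
    {r k : ι → ℕ} {q s : ℕ}
    (Q : ∀ i : ι, Matrix (Fin (r i)) (Fin (k i)) ℂ)
    (hQ : ∀ i : ι, (Q i)ᴴ * Q i = 1)
    (Qhat : Matrix (Σ i : ι, Fin (k i)) (Fin q) ℂ)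
    (hQhat : Qhatᴴ * Qhat = 1)
    (G : Matrix (Σ i : ι, Fin (r i)) (Fin s) ℂ)
    (x : EuclideanSpace ℂ (Fin s)) :
    letI U : Matrix (Σ i : ι, Fin (r i)) (Σ i : ι, Fin (k i)) ℂ := Matrix.blockDiagonal' Q
    letI Qfull : Matrix (Σ i : ι, Fin (r i)) (Fin q) ℂ := U * Qhat
    ‖Matrix.toEuclideanLin (G - Qfull * Qfullᴴ * G) x‖ ^ 2 =
      (∑ i : ι,
        ‖Matrix.toEuclideanLin
            (G.submatrix (Sigma.mk i) id
              - Q i * (Q i)ᴴ * G.submatrix (Sigma.mk i) id) x‖ ^ 2)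
      + ‖Matrix.toEuclideanLin ((1 - Qhat * Qhatᴴ) * Uᴴ * G) x‖ ^ 2 := by
  set U := blockDiagonal' Q with hU_def
  set Qfull := U * Qhat with hQfull_def
  have hU : Uᴴ * U = 1 := by
    simp only [hU_def, blockDiagonal'_conjTranspose, ← blockDiagonal'_mul, hQ]
    exact blockDiagonal'_one
  have hQfull : Qfullᴴ * Qfull = 1 := by
    rw [show Qfullᴴ * Qfull = Qhatᴴ * (Uᴴ * U) * Qhat by
      simp only [hQfull_def, conjTranspose_mul, Matrix.mul_assoc], hU, Matrix.mul_one, hQhat]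
  have hblock (i : ι) : G.submatrix (Sigma.mk i) id - Q i * (Q i)ᴴ * G.submatrix (Sigma.mk i) id
      = (G - U * Uᴴ * G).submatrix (Sigma.mk i) id := by
    rw [Matrix.mul_assoc, Matrix.mul_assoc, submatrix_sub, Pi.sub_apply, Pi.sub_apply,
      hU_def,
      submatrix_blockDiagonal'_mul, blockDiagonal'_conjTranspose, submatrix_blockDiagonal'_mul]
  simp only [hblock]
  rw [sum_norm_sq_toEuclideanLin_rowBlock]
  apply norm_sq_toEuclideanLin_eq_add
  rw [Matrix.mul_assoc (1 - Qhat * Qhatᴴ), Matrix.sub_mul, Matrix.one_mul,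
    conjTranspose_mul_self_sub_isometry hQfull, conjTranspose_mul_self_sub_isometry hU,
    conjTranspose_mul_self_sub_isometry hQhat]
  simp only [hQfull_def, conjTranspose_mul, conjTranspose_conjTranspose, Matrix.mul_assoc]
  abel
end

section
/- Let L ≥ 1, let n₀, n₁, …, n_L be finite index types, and for each j ∈ {1,…,L} let U_j be an isometric complex matrix of size n_{j−1} × n_j. Define the partial products P_j := U_1 U_2 ⋯ U_j (each isometric). Then for every complex matrix G of size n₀ × s and every vector x ∈ ℂˢ, ‖(I − P_L P_Lᴴ) G x‖² = ‖(I − U_1 U_1ᴴ) G x‖² + Σ_{j=2}^{L} ‖(I − U_j U_jᴴ) P_{j−1}ᴴ G x‖², where ‖·‖ is the Euclidean norm. -/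
open Matrix

theorem norm_sq_toEuclideanLin_eq_re_inner {m k : Type*} [Fintype m] [DecidableEq m]
    [Fintype k] [DecidableEq k] (M : Matrix m k ℂ) (x : EuclideanSpace ℂ k) :
    ‖Matrix.toEuclideanLin M x‖ ^ 2 =
      RCLike.re (inner ℂ x (Matrix.toEuclideanLin (Mᴴ * M) x)) := by
  have hcomp : Matrix.toEuclideanLin (Mᴴ * M) x =
      Matrix.toEuclideanLin Mᴴ (Matrix.toEuclideanLin M x) := by
    simp [Matrix.toLpLin_apply, Matrix.mulVec_mulVec]
  rw [hcomp, Matrix.toEuclideanLin_conjTranspose_eq_adjoint, LinearMap.adjoint_inner_right,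
    inner_self_eq_norm_sq]

/-- Pythagoras for the orthogonal projection `A * Aᴴ` onto the range of an isometric matrix. -/
theorem norm_sq_toEuclideanLin_one_sub_mul_conjTranspose_mul {m k l : Type*}
    [Fintype m] [DecidableEq m] [Fintype k] [DecidableEq k] [Fintype l] [DecidableEq l]
    {A : Matrix m k ℂ} (hA : Aᴴ * A = 1) (B : Matrix m l ℂ) (x : EuclideanSpace ℂ l) :
    ‖Matrix.toEuclideanLin ((1 - A * Aᴴ) * B) x‖ ^ 2 =
      ‖Matrix.toEuclideanLin B x‖ ^ 2 - ‖Matrix.toEuclideanLin (Aᴴ * B) x‖ ^ 2 := by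
  have hidem : A * Aᴴ * (A * Aᴴ) = A * Aᴴ := by
    rw [Matrix.mul_assoc, ← Matrix.mul_assoc Aᴴ, hA, Matrix.one_mul]
  have hproj : (1 - A * Aᴴ) * (1 - A * Aᴴ) = 1 - A * Aᴴ := by
    rw [mul_sub, mul_one, sub_mul, one_mul, hidem, sub_self, sub_zero]
  have hgram : ((1 - A * Aᴴ) * B)ᴴ * ((1 - A * Aᴴ) * B) = Bᴴ * B - (Aᴴ * B)ᴴ * (Aᴴ * B) := by
    have hherm : (1 - A * Aᴴ)ᴴ = 1 - A * Aᴴ := by simp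
    rw [Matrix.conjTranspose_mul, hherm, Matrix.mul_assoc, ← Matrix.mul_assoc (1 - A * Aᴴ), hproj]
    simp [Matrix.sub_mul, Matrix.mul_sub, Matrix.mul_assoc]
  simp only [norm_sq_toEuclideanLin_eq_re_inner, hgram]
  rw [map_sub, LinearMap.sub_apply, inner_sub_right, map_sub]

/-- Telescoping Pythagoras identity for nested isometric bases.
With 0-based indexing, `U j` (for `j < L`) is the matrix called `U_{j+1}` in the paper,
and the partial products satisfy `P 0 = 1` and `P (j+1) = P j * U j`, so that
`P j = U_1 ⋯ U_j`.  Then for every matrix `G` and vector `x`,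
`‖(I - P L (P L)ᴴ) G x‖²
  = ‖(I - U_1 U_1ᴴ) G x‖² + ∑_{j=2}^{L} ‖(I - U_j U_jᴴ) P_{j-1}ᴴ G x‖²`,
where the sum over `j = 2, …, L` of the paper appears below as the sum over the 0-based
indices `i = j - 1 ∈ Finset.Ico 1 L`. -/
theorem telescoping_pythagoras_partial_products
    {L : ℕ} (hL : 1 ≤ L) {n : ℕ → ℕ} {s : ℕ}
    (U : ∀ j : ℕ, Matrix (Fin (n j)) (Fin (n (j + 1))) ℂ)
    (hU : ∀ j : ℕ, j < L → (U j)ᴴ * U j = 1)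
    (P : ∀ j : ℕ, Matrix (Fin (n 0)) (Fin (n j)) ℂ)
    (hP0 : P 0 = 1)
    (hPsucc : ∀ j : ℕ, P (j + 1) = P j * U j)
    (G : Matrix (Fin (n 0)) (Fin s) ℂ)
    (x : EuclideanSpace ℂ (Fin s)) :
    ‖Matrix.toEuclideanLin ((1 - P L * (P L)ᴴ) * G) x‖ ^ 2 =
      ‖Matrix.toEuclideanLin ((1 - U 0 * (U 0)ᴴ) * G) x‖ ^ 2 +
        ∑ i ∈ Finset.Ico 1 L,
          ‖Matrix.toEuclideanLin ((1 - U i * (U i)ᴴ) * (P i)ᴴ * G) x‖ ^ 2 := by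
  have hP : ∀ j ≤ L, (P j)ᴴ * P j = 1 := by
    intro j
    induction j with
    | zero => simp [hP0]
    | succ j ih =>
      intro hj
      rw [hPsucc, Matrix.conjTranspose_mul, Matrix.mul_assoc, ← Matrix.mul_assoc (P j)ᴴ,
        ih (by lia), Matrix.one_mul, hU j hj]
  have hterm : ∀ i < L, ‖Matrix.toEuclideanLin ((1 - U i * (U i)ᴴ) * (P i)ᴴ * G) x‖ ^ 2 =
      ‖Matrix.toEuclideanLin ((P i)ᴴ * G) x‖ ^ 2 -
        ‖Matrix.toEuclideanLin ((P (i + 1))ᴴ * G) x‖ ^ 2 := by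
    intro i hi
    rw [Matrix.mul_assoc, norm_sq_toEuclideanLin_one_sub_mul_conjTranspose_mul (hU i hi), hPsucc,
      Matrix.conjTranspose_mul, Matrix.mul_assoc]
  have hzero : (1 - U 0 * (U 0)ᴴ) * G = (1 - U 0 * (U 0)ᴴ) * (P 0)ᴴ * G := by simp [hP0]
  have hsum := Finset.sum_eq_sum_Ico_succ_bot (by lia : 0 < L)
    (fun i ↦ ‖Matrix.toEuclideanLin ((1 - U i * (U i)ᴴ) * (P i)ᴴ * G) x‖ ^ 2)
  rw [← Finset.range_eq_Ico, Finset.sum_congr rfl fun i hi ↦ hterm i (Finset.mem_range.mp hi),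
    Finset.sum_range_sub' (fun i ↦ ‖Matrix.toEuclideanLin ((P i)ᴴ * G) x‖ ^ 2)] at hsum
  simp only [zero_add] at hsum
  rw [hzero, ← hsum, norm_sq_toEuclideanLin_one_sub_mul_conjTranspose_mul (hP L le_rfl)]
  simp [hP0]
end
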